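/- arXiv:2310.12275 — 4 statements merged into one kernel-verified Lean document; each statement's English description precedes it below -/
import Mathlib

section
/- For every real t with 0 < t < 1 and every real χ > 0, the following holds: for each integer x the series Σ_{m=0}^{∞} e^{−χ t^{x−m}} (−1)^m t^{m(m−1)/2}/(t;t)_m converges absolutely; the resulting values are summable over x ∈ ℤ; and Σ_{x∈ℤ} Σ_{m=0}^{∞} e^{−χ t^{x−m}} (−1)^m t^{m(m−1)/2}/(t;t)_m = (t;t)_∞. -/
open scoped BigOperators

/-- `(t;t)_n = ∏_{r=1}^{n} (1 - t^r)`. -/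
noncomputable def tPochN (t : ℝ) (n : ℕ) : ℝ := ∏ r ∈ Finset.range n, (1 - t ^ (r + 1))

/-- `(t;t)_∞ = ∏_{r=1}^{∞} (1 - t^r)`. -/
noncomputable def tPochInf (t : ℝ) : ℝ := ∏' r : ℕ, (1 - t ^ (r + 1))

/-- The `m`-th term of the series defining the weight of `𝓛^{(1)}_{t,χ}` at `x`:
`e^{-χ t^{x-m}} (-1)^m t^{m(m-1)/2} / (t;t)_m`. -/
noncomputable def lterm (t χ : ℝ) (x : ℤ) (m : ℕ) : ℝ :=
  Real.exp (-χ * t ^ (x - (m : ℤ))) * (-1) ^ m * t ^ (m * (m - 1) / 2) / tPochN t m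

open Filter Topology in
theorem aux_telescope {f : ℤ → ℝ} (hm : Monotone f) (h1 : Tendsto f atTop (𝓝 1))
    (h0 : Tendsto f atBot (𝓝 0)) : HasSum (fun x : ℤ => f x - f (x - 1)) 1 := by
  have hg : ∀ x, 0 ≤ f x - f (x - 1) := fun x => sub_nonneg.2 (hm (by omega))
  have A : HasSum (fun n : ℕ => f (n : ℤ) - f ((n : ℤ) - 1)) (1 - f (-1)) := by
    rw [hasSum_iff_tendsto_nat_of_nonneg (fun n => hg n)]
    have e : ∀ n : ℕ, ∑ i ∈ Finset.range n, (f (i : ℤ) - f ((i : ℤ) - 1)) = f ((n : ℤ) - 1) - f (-1) := by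
      intro n
      induction n with
      | zero => simp
      | succ k ih => rw [Finset.sum_range_succ, ih]; push_cast; simp
    simp_rw [e]
    refine Tendsto.sub_const ?_ _
    exact h1.comp (tendsto_atTop_add_const_right _ (-1) tendsto_natCast_atTop_atTop)
  have B : HasSum (fun n : ℕ => f (-((n : ℤ) + 1)) - f (-((n : ℤ) + 1) - 1)) (f (-1) - 0) := by
    rw [hasSum_iff_tendsto_nat_of_nonneg (fun n => hg _)]
    have e : ∀ n : ℕ, ∑ i ∈ Finset.range n, (f (-((i : ℤ) + 1)) - f (-((i : ℤ) + 1) - 1))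
        = f (-1) - f (-((n : ℤ) + 1)) := by
      intro n
      induction n with
      | zero => simp
      | succ k ih =>
        rw [Finset.sum_range_succ, ih]; push_cast
        rw [show -((k : ℤ) + 1) - 1 = -((k : ℤ) + 1 + 1) by ring]; ring
    simp_rw [e]
    refine Tendsto.const_sub _ ?_
    refine h0.comp (tendsto_neg_atTop_atBot.comp ?_)
    exact tendsto_atTop_add_const_right _ (1) tendsto_natCast_atTop_atTop
  have := HasSum.of_nat_of_neg_add_one (f := fun x : ℤ => f x - f (x - 1)) A B
  simpa using this

noncomputable def cc (t : ℝ) (m : ℕ) : ℝ := (-1) ^ m * t ^ (m * (m - 1) / 2) / tPochN t m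

theorem tPochN_pos {t : ℝ} (ht0 : 0 < t) (ht1 : t < 1) (m : ℕ) : 0 < tPochN t m :=
  Finset.prod_pos fun r _ => sub_pos.2 (pow_lt_one₀ ht0.le ht1 (by omega))

theorem cc_rec {t : ℝ} (ht0 : 0 < t) (ht1 : t < 1) (m : ℕ) :
    cc t (m + 1) * (1 - t ^ (m + 1)) = - t ^ m * cc t m := by
  have h1 : (0:ℝ) < 1 - t ^ (m + 1) := sub_pos.2 (pow_lt_one₀ ht0.le ht1 (by omega))
  have h2 := tPochN_pos ht0 ht1 m
  have h3 : tPochN t (m + 1) = tPochN t m * (1 - t ^ (m + 1)) := Finset.prod_range_succ _ _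
  have h4 : (m + 1) * (m + 1 - 1) / 2 = m * (m - 1) / 2 + m := by
    rw [← Nat.add_mul_div_right _ _ (by norm_num : 0 < 2)]
    congr 1
    cases m with
    | zero => rfl
    | succ k => simp; ring
  unfold cc
  rw [h3, h4]
  have := h1.ne'
  have := h2.ne'
  field_simp
  ring

theorem cc_zero (t : ℝ) : cc t 0 = 1 := by simp [cc, tPochN]

theorem cc_ne {t : ℝ} (ht0 : 0 < t) (ht1 : t < 1) (m : ℕ) : cc t m ≠ 0 := by
  have h2 := tPochN_pos ht0 ht1 m
  unfold cc
  positivity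

open Filter Topology in
theorem cc_summable {t : ℝ} (ht0 : 0 < t) (ht1 : t < 1) : Summable (cc t) := by
  refine summable_of_ratio_test_tendsto_lt_one (l := 0) one_pos
    (Eventually.of_forall (cc_ne ht0 ht1)) ?_
  have e : ∀ m, ‖cc t (m + 1)‖ / ‖cc t m‖ = t ^ m / (1 - t ^ (m + 1)) := by
    intro m
    have h1 : (0:ℝ) < 1 - t ^ (m + 1) := sub_pos.2 (pow_lt_one₀ ht0.le ht1 (by omega))
    have h := congrArg norm (cc_rec ht0 ht1 m)
    rw [norm_mul, norm_mul, norm_neg, Real.norm_of_nonneg h1.le,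
      Real.norm_of_nonneg (pow_nonneg ht0.le m)] at h
    rw [div_eq_div_iff (norm_ne_zero_iff.2 (cc_ne ht0 ht1 m)) h1.ne', h]
  simp_rw [e]
  have h := tendsto_pow_atTop_nhds_zero_of_lt_one ht0.le ht1
  have h' := h.div ((h.comp (tendsto_add_atTop_nat 1)).const_sub 1) (by norm_num)
  simpa [Pi.div_def] using h'

theorem cc_mul_summable {t : ℝ} (ht0 : 0 < t) (ht1 : t < 1) {u : ℕ → ℝ}
    (hu : ∀ m, |u m| ≤ 1) : Summable (fun m => u m * cc t m) := by
  refine Summable.of_norm_bounded (cc_summable ht0 ht1).norm fun m => ?_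
  rw [norm_mul]
  exact mul_le_of_le_one_left (norm_nonneg _) (hu m)

theorem abs_pow_le {z : ℝ} (h0 : 0 ≤ z) (h1 : z ≤ 1) (m : ℕ) : |z ^ m| ≤ 1 := by
  rw [abs_of_nonneg (pow_nonneg h0 m)]; exact pow_le_one₀ h0 h1

theorem euler_step {t : ℝ} (ht0 : 0 < t) (ht1 : t < 1) {z : ℝ} (h0 : 0 ≤ z) (h1 : z ≤ 1) :
    ∑' m, z ^ m * cc t m = (1 - z) * ∑' m, (t * z) ^ m * cc t m := by
  have htz0 : 0 ≤ t * z := by positivity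
  have htz1 : t * z ≤ 1 := by nlinarith
  have s1 := cc_mul_summable ht0 ht1 (abs_pow_le h0 h1)
  have s2 := cc_mul_summable ht0 ht1 (abs_pow_le htz0 htz1)
  have s1' := (summable_nat_add_iff 1).2 s1
  have s2' := (summable_nat_add_iff 1).2 s2
  have k : ∑' m, z ^ (m + 1) * cc t (m + 1) - ∑' m, (t * z) ^ (m + 1) * cc t (m + 1)
      = - z * ∑' m, (t * z) ^ m * cc t m := by
    rw [← s1'.tsum_sub s2', ← tsum_mul_left]
    refine tsum_congr fun m => ?_
    have := cc_rec ht0 ht1 m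
    rw [mul_pow, mul_pow]
    linear_combination z ^ (m + 1) * this
  have e1 := s1.tsum_eq_zero_add
  have e2 := s2.tsum_eq_zero_add
  simp only [pow_zero] at e1 e2
  linarith

open Filter Topology in
theorem euler {t : ℝ} (ht0 : 0 < t) (ht1 : t < 1) :
    ∑' m, t ^ m * cc t m = tPochInf t := by
  have key : ∀ n : ℕ, ∑' m, t ^ m * cc t m
      = (∏ r ∈ Finset.range n, (1 - t ^ (r + 1))) * ∑' m, (t ^ (n + 1)) ^ m * cc t m := by
    intro n
    induction n with
    | zero => simp
    | succ k ih =>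
      rw [ih, euler_step ht0 ht1 (pow_nonneg ht0.le _) (pow_le_one₀ ht0.le ht1.le),
        Finset.prod_range_succ, pow_succ' t (k + 1)]
      ring
  have lim : Tendsto (fun n : ℕ => ∑' m, (t ^ (n + 1)) ^ m * cc t m) atTop (𝓝 1) := by
    have : (1 : ℝ) = ∑' m, (if m = 0 then 1 else 0) := by simp
    rw [this]
    refine tendsto_tsum_of_dominated_convergence (cc_summable ht0 ht1).norm ?_ ?_
    · intro m
      rcases Nat.eq_zero_or_pos m with rfl | hm
      · simp [cc_zero]
      · have h := (tendsto_pow_atTop_nhds_zero_of_lt_one ht0.le ht1).comp (tendsto_add_atTop_nat 1)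
        have h' := (h.pow m).mul_const (cc t m)
        simpa [hm.ne'] using h'
    · refine Eventually.of_forall fun n m => ?_
      rw [norm_mul]
      exact mul_le_of_le_one_left (norm_nonneg _)
        (abs_pow_le (pow_nonneg ht0.le _) (pow_le_one₀ ht0.le ht1.le) m)
  have mult : Multipliable (fun r : ℕ => 1 - t ^ (r + 1)) := by
    simp_rw [sub_eq_add_neg]
    refine Real.multipliable_one_add_of_summable ?_
    exact ((summable_nat_add_iff 1).2 (summable_geometric_of_lt_one ht0.le ht1)).neg
  have h := mult.hasProd.tendsto_prod_nat.mul lim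
  rw [mul_one] at h
  refine tendsto_nhds_unique ?_ h
  refine Tendsto.congr key ?_
  exact tendsto_const_nhds

open Filter Topology in
theorem stmt0 (t χ : ℝ) (ht0 : 0 < t) (ht1 : t < 1) (hχ : 0 < χ) :
    (∀ x : ℤ, Summable fun m : ℕ => |lterm t χ x m|) ∧
    (Summable fun x : ℤ => ∑' m : ℕ, lterm t χ x m) ∧
    ∑' (x : ℤ), ∑' (m : ℕ), lterm t χ x m = tPochInf t := by
  set f : ℤ → ℝ := fun x => Real.exp (-χ * t ^ x) with hf
  have hl : ∀ (x : ℤ) (m : ℕ), lterm t χ x m = f (x - m) * cc t m := by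
    intro x m; simp only [lterm, cc, hf]; ring
  have hf1 : ∀ x, |f x| ≤ 1 := by
    intro x
    rw [abs_of_pos (Real.exp_pos _), Real.exp_le_one_iff]
    have : 0 < t ^ x := zpow_pos ht0 x
    nlinarith [mul_pos hχ this]
  have hs : ∀ x : ℤ, Summable fun m : ℕ => f (x - m) * cc t m :=
    fun x => cc_mul_summable ht0 ht1 (fun m => hf1 _)
  have hm : Monotone f := by
    intro a b hab
    apply Real.exp_le_exp.2
    have : t ^ b ≤ t ^ a := (zpow_le_zpow_iff_right_of_lt_one₀ ht0 ht1).2 hab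
    nlinarith
  have hpow1 : Tendsto (fun x : ℤ => t ^ x) atTop (𝓝 0) := by
    rw [← Nat.map_cast_int_atTop, tendsto_map'_iff]
    simpa [Function.comp_def] using tendsto_pow_atTop_nhds_zero_of_lt_one ht0.le ht1
  have h1 : Tendsto f atTop (𝓝 1) := by
    have := (Real.continuous_exp.tendsto _).comp (hpow1.const_mul (-χ))
    simpa [Function.comp_def, hf] using this
  have hpow0 : Tendsto (fun x : ℤ => t ^ x) atBot atTop := by
    have h : Tendsto (fun x : ℤ => (t ^ x)⁻¹) atTop atTop := by
      refine Tendsto.inv_tendsto_nhdsGT_zero ?_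
      rw [tendsto_nhdsWithin_iff]
      exact ⟨hpow1, Eventually.of_forall fun x => zpow_pos ht0 x⟩
    have h2 := h.comp tendsto_neg_atBot_atTop
    simpa [Function.comp_def] using h2
  have h0 : Tendsto f atBot (𝓝 0) := by
    refine Real.tendsto_exp_atBot.comp ?_
    exact hpow0.const_mul_atTop_of_neg (by linarith)
  have hg := aux_telescope hm h1 h0
  set g : ℤ → ℝ := fun x => f x - f (x - 1) with hgdef
  set d : ℕ → ℝ := fun m => t ^ m * cc t m with hd
  have hdrec : ∀ m, cc t (m + 1) = d (m + 1) - d m := by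
    intro m
    have := cc_rec ht0 ht1 m
    simp only [hd]
    linarith
  have hds : Summable d := cc_mul_summable ht0 ht1 (abs_pow_le ht0.le ht1.le)
  have hfd : ∀ x : ℤ, Summable fun m : ℕ => f (x - m) * d m := by
    intro x
    have := cc_mul_summable ht0 ht1 (u := fun m : ℕ => f (x - m) * t ^ m) (fun m => by
      rw [abs_mul]; exact mul_le_one₀ (hf1 _) (abs_nonneg _) (abs_pow_le ht0.le ht1.le m))
    simpa [hd, mul_assoc] using this
  have hS : ∀ x : ℤ, ∑' m : ℕ, lterm t χ x m = ∑' m : ℕ, d m * g (x - m) := by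
    intro x
    simp_rw [hl]
    have e1 := (hs x).tsum_eq_zero_add
    have e2 := (hfd x).tsum_eq_zero_add
    have s2 := (summable_nat_add_iff 1).2 (hfd x)
    have s3 := hfd (x - 1)
    have e3 : ∑' m : ℕ, f (x - ((m + 1 : ℕ) : ℤ)) * cc t (m + 1)
        = ∑' m : ℕ, f (x - ((m + 1 : ℕ) : ℤ)) * d (m + 1) - ∑' m : ℕ, f (x - 1 - m) * d m := by
      rw [← s2.tsum_sub s3]
      refine tsum_congr fun m => ?_
      rw [hdrec, show x - 1 - (m : ℤ) = x - ((m + 1 : ℕ) : ℤ) by push_cast; ring]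
      ring
    have e4 : ∑' m : ℕ, d m * g (x - m)
        = ∑' m : ℕ, f (x - m) * d m - ∑' m : ℕ, f (x - 1 - m) * d m := by
      rw [← (hfd x).tsum_sub s3]
      refine tsum_congr fun m => ?_
      simp only [hgdef]
      rw [show x - 1 - (m : ℤ) = x - m - 1 by ring]
      ring
    have e5 : d 0 = cc t 0 := by simp [hd]
    rw [e4, e1, e3, e2, e5]
    ring
  have hprod : HasSum (fun p : ℕ × ℤ => d p.1 * g p.2) (tPochInf t) := by
    have hsum := summable_mul_of_summable_norm hds.norm hg.summable.norm
    have := hds.hasSum.mul hg hsum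
    rwa [mul_one, euler ht0 ht1] at this
  let e : ℤ × ℕ ≃ ℕ × ℤ :=
    { toFun := fun p => (p.2, p.1 - p.2)
      invFun := fun q => (q.2 + q.1, q.1)
      left_inv := fun p => by simp
      right_inv := fun q => by simp }
  have hprod2 : HasSum (fun p : ℤ × ℕ => d p.2 * g (p.1 - p.2)) (tPochInf t) :=
    (e.hasSum_iff (f := fun p : ℕ × ℤ => d p.1 * g p.2)).2 hprod
  have hfin : HasSum (fun x : ℤ => ∑' m : ℕ, lterm t χ x m) (tPochInf t) := by
    simp_rw [hS]
    exact hprod2.prod_fiberwise fun x => (hprod2.summable.prod_factor x).hasSum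
  refine ⟨fun x => ?_, hfin.summable, hfin.tsum_eq⟩
  simp_rw [hl]
  exact (hs x).abs
end

section
/- For every real t with 0 < t < 1, every real χ > 0 and every integer x, the absolutely convergent series Σ_{m=0}^{∞} e^{−χ t^{x−m}} (−1)^m t^{m(m−1)/2}/(t;t)_m has nonnegative sum. -/
open scoped BigOperators

lemma tP_succ (t : ℝ) (n : ℕ) : tPochN t (n+1) = tPochN t n * (1 - t^(n+1)) := by
  unfold tPochN; rw [Finset.prod_range_succ]

lemma one_sub_pos' {t : ℝ} (ht0 : 0 < t) (ht1 : t < 1) (r : ℕ) : 0 < 1 - t^(r+1) := by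
  have : t^(r+1) < 1 := pow_lt_one₀ ht0.le ht1 (Nat.succ_ne_zero r)
  linarith

lemma tP_pos {t : ℝ} (ht0 : 0 < t) (ht1 : t < 1) (n : ℕ) : 0 < tPochN t n := by
  unfold tPochN
  exact Finset.prod_pos fun r _ => one_sub_pos' ht0 ht1 r

noncomputable def acf (t : ℝ) (m : ℕ) : ℝ := (-1)^m * t^(m*(m-1)/2) / tPochN t m

lemma acf_succ {t : ℝ} (ht0 : 0 < t) (ht1 : t < 1) (m : ℕ) :
    acf t (m+1) * (1 - t^(m+1)) = - t^m * acf t m := by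
  unfold acf
  have h1 := (tP_pos ht0 ht1 m).ne'
  have h2 := (one_sub_pos' ht0 ht1 m).ne'
  have h3 : (m+1)*(m+1-1)/2 = m + m*(m-1)/2 := by
    have := Nat.triangle_succ m
    rw [this, add_comm]
  rw [tP_succ, h3, pow_add, pow_succ]
  field_simp
  ring

noncomputable def Ff (t : ℝ) (n : ℕ) (c : ℝ) : ℝ :=
  ∑ m ∈ Finset.range (n+1), acf t m / tPochN t (n-m) * Real.exp (-c * (t^m)⁻¹)

lemma Pdiv {t : ℝ} (ht0 : 0 < t) (ht1 : t < 1) (n m : ℕ) (h : m < n + 1) :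
    (1 - t^(n+1-m)) / tPochN t (n+1-m) = 1 / tPochN t (n-m) := by
  obtain ⟨k, rfl⟩ := Nat.exists_eq_add_of_le (Nat.lt_succ_iff.mp h)
  have e1 : m + k + 1 - m = k + 1 := by omega
  have e2 : m + k - m = k := by omega
  have h1 := (tP_pos ht0 ht1 k).ne'
  have h2 := (one_sub_pos' ht0 ht1 k).ne'
  rw [e1, e2, tP_succ]
  field_simp

lemma Ff_zero_succ {t : ℝ} (ht0 : 0 < t) (ht1 : t < 1) (n : ℕ) :
    (1 - t^(n+1)) * Ff t (n+1) 0 = (1 - t^n) * Ff t n 0 := by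
  unfold Ff
  simp only [neg_zero, zero_mul, Real.exp_zero, mul_one]
  have key : (1 - t^(n+1)) * ∑ m ∈ Finset.range (n+1+1), acf t m / tPochN t (n+1-m)
      = ∑ m ∈ Finset.range (n+1+1), acf t m * ((1 - t^(n+1-m)) / tPochN t (n+1-m))
        + ∑ m ∈ Finset.range (n+1+1), t^(n+1-m) * (acf t m * (1 - t^m)) / tPochN t (n+1-m) := by
    rw [Finset.mul_sum, ← Finset.sum_add_distrib]
    refine Finset.sum_congr rfl fun m hm => ?_
    have : t^(n+1) = t^(n+1-m) * t^m := by
      rw [← pow_add]; congr 1; have := Finset.mem_range.mp hm; omega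
    rw [this]; ring
  rw [key, Finset.sum_range_succ, Finset.sum_range_succ' (n := n+1)]
  simp only [Nat.sub_self, pow_zero, sub_self, zero_div, mul_zero, add_zero]
  rw [← Finset.sum_add_distrib, Finset.mul_sum]
  refine Finset.sum_congr rfl fun m hm => ?_
  have hm' := Finset.mem_range.mp hm
  rw [Pdiv ht0 ht1 n m hm', acf_succ ht0 ht1]
  have e : n + 1 - (m+1) = n - m := by omega
  have : t^n = t^(n-m) * t^m := by
    rw [← pow_add]; congr 1; omega
  rw [e, this]; ring

lemma Ff_zero_nonneg {t : ℝ} (ht0 : 0 < t) (ht1 : t < 1) (n : ℕ) : 0 ≤ Ff t n 0 := by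
  induction n with
  | zero => simp [Ff, acf, tPochN]
  | succ n ih =>
    have h := Ff_zero_succ ht0 ht1 n
    have h2 := one_sub_pos' ht0 ht1 n
    have h3 : 0 ≤ 1 - t^n := by
      have := pow_le_one₀ ht0.le ht1.le (n := n); linarith
    have h4 : 0 ≤ (1 - t^(n+1)) * Ff t (n+1) 0 := h ▸ mul_nonneg h3 ih
    exact nonneg_of_mul_nonneg_right h4 h2

lemma Ff_deriv {t : ℝ} (ht0 : 0 < t) (ht1 : t < 1) (n : ℕ) (c : ℝ) :
    HasDerivAt (Ff t (n+1)) ((t^(n+1))⁻¹ * Ff t n c - (t^(n+1))⁻¹ * Ff t (n+1) c) c := by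
  have h : HasDerivAt (Ff t (n+1)) (∑ m ∈ Finset.range (n+1+1),
      acf t m / tPochN t (n+1-m) * (Real.exp (-c * (t^m)⁻¹) * (-1 * (t^m)⁻¹))) c := by
    unfold Ff
    refine HasDerivAt.fun_sum fun m _ => ?_
    exact (((hasDerivAt_id c).neg.mul_const _).exp).const_mul _
  convert h using 1
  rw [sub_eq_iff_eq_add]
  unfold Ff
  rw [Finset.mul_sum, Finset.mul_sum, ← Finset.sum_add_distrib]
  have : ∀ m ∈ Finset.range (n+1+1), acf t m / tPochN t (n+1-m) * (Real.exp (-c * (t^m)⁻¹) * (-1 * (t^m)⁻¹)) + (t^(n+1))⁻¹ * (acf t m / tPochN t (n+1-m) * Real.exp (-c * (t^m)⁻¹))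
     = (t^(n+1))⁻¹ * (acf t m * ((1 - t^(n+1-m)) / tPochN t (n+1-m)) * Real.exp (-c * (t^m)⁻¹)) := by
    intro m hm
    have e : t^(n+1) = t^(n+1-m) * t^m := by
      rw [← pow_add]; congr 1; have := Finset.mem_range.mp hm; omega
    have e2 : (t^m)⁻¹ = (t^(n+1))⁻¹ * t^(n+1-m) := by
      rw [e]; field_simp
    generalize Real.exp (-c * (t^m)⁻¹) = E
    rw [e2]; ring
  rw [Finset.sum_congr rfl this, Finset.sum_range_succ (n := n+1)]
  simp only [Nat.sub_self, pow_zero, sub_self, zero_div, mul_zero, zero_mul, add_zero]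
  refine Finset.sum_congr rfl fun m hm => ?_
  rw [Pdiv ht0 ht1 n m (Finset.mem_range.mp hm)]; ring

lemma Ff_nonneg {t : ℝ} (ht0 : 0 < t) (ht1 : t < 1) (n : ℕ) :
    ∀ c : ℝ, 0 ≤ c → 0 ≤ Ff t n c := by
  induction n with
  | zero => intro c _; simp [Ff, acf, tPochN]; positivity
  | succ n ih =>
    intro c hc
    set l := (t^(n+1))⁻¹ with hl
    have hlp : 0 < l := by positivity
    have hd : ∀ y, HasDerivAt (fun y => Real.exp (y * l) * Ff t (n+1) y)
        (Real.exp (y * l) * (l * Ff t n y)) y := by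
      intro y
      have h := (((hasDerivAt_id y).mul_const l).exp).mul (Ff_deriv ht0 ht1 n y)
      refine HasDerivAt.congr_deriv h ?_
      change Real.exp (y * l) * (1 * l) * Ff t (n+1) y
        + Real.exp (y * l) * (l * Ff t n y - l * Ff t (n+1) y) = _
      ring
    have hm : MonotoneOn (fun y => Real.exp (y * l) * Ff t (n+1) y) (Set.Ici 0) := by
      refine monotoneOn_of_deriv_nonneg (convex_Ici 0)
        (fun y _ => (hd y).continuousAt.continuousWithinAt)
        (fun y _ => (hd y).differentiableAt.differentiableWithinAt) ?_
      intro y hy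
      rw [interior_Ici] at hy
      rw [(hd y).deriv]
      have := ih y (le_of_lt hy)
      positivity
    have h := hm (Set.mem_Ici.mpr le_rfl) (Set.mem_Ici.mpr hc) hc
    simp only [zero_mul, Real.exp_zero, one_mul] at h
    have h2 := (Ff_zero_nonneg ht0 ht1 (n+1)).trans h
    exact nonneg_of_mul_nonneg_right h2 (Real.exp_pos _)

lemma tP_anti {t : ℝ} (ht0 : 0 < t) (ht1 : t < 1) : Antitone (tPochN t) := by
  refine antitone_nat_of_succ_le fun n => ?_
  rw [tP_succ]
  have := tP_pos ht0 ht1 n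
  have : 0 < t^(n+1) := by positivity
  nlinarith

lemma ratio_tendsto {t : ℝ} (ht0 : 0 < t) (ht1 : t < 1) (m : ℕ) :
    Filter.Tendsto (fun k => tPochN t (k+m) / tPochN t k) Filter.atTop (nhds 1) := by
  induction m with
  | zero =>
    have : (fun k => tPochN t (k+0) / tPochN t k) = fun _ => 1 := by
      funext k; exact div_self (tP_pos ht0 ht1 k).ne'
    rw [this]; exact tendsto_const_nhds
  | succ m ih =>
    have h1 : Filter.Tendsto (fun k : ℕ => 1 - t^(k+(m+1))) Filter.atTop (nhds (1 - 0)) :=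
      tendsto_const_nhds.sub ((Filter.tendsto_add_atTop_iff_nat (m+1)).mpr
        (tendsto_pow_atTop_nhds_zero_of_lt_one ht0.le ht1))
    have h := ih.mul h1
    simp only [sub_zero, mul_one] at h
    refine h.congr fun k => ?_
    rw [← add_assoc, tP_succ]; ring

theorem stmt1 (t χ : ℝ) (ht0 : 0 < t) (ht1 : t < 1) (hχ : 0 < χ) (x : ℤ) :
    0 ≤ ∑' m : ℕ, lterm t χ x m := by
  by_cases hs : Summable (fun m => lterm t χ x m)
  swap
  · rw [tsum_eq_zero_of_not_summable hs]
  set c := χ * t^x with hc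
  have hcp : 0 ≤ c := by positivity
  have hl : ∀ m, lterm t χ x m = acf t m * Real.exp (-c * (t^m)⁻¹) := by
    intro m
    unfold lterm acf
    rw [zpow_sub₀ ht0.ne', zpow_natCast, hc]
    have : -χ * (t^x / t^m) = -(χ * t^x) * (t^m)⁻¹ := by ring
    rw [this]; ring
  let g : ℕ → ℕ → ℝ := fun n m =>
    if m ∈ Finset.range (n+1) then lterm t χ x m * (tPochN t n / tPochN t (n-m)) else 0
  have hg : ∀ n, ∑' m, g n m = tPochN t n * Ff t n c := by
    intro n
    rw [tsum_eq_sum (s := Finset.range (n+1)) (fun m hm => if_neg hm)]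
    unfold Ff
    rw [Finset.mul_sum]
    refine Finset.sum_congr rfl fun m hm => ?_
    simp only [g, if_pos hm, hl]; ring
  have hlim : Filter.Tendsto (fun n => ∑' m, g n m) Filter.atTop
      (nhds (∑' m, lterm t χ x m)) := by
    refine tendsto_tsum_of_dominated_convergence (bound := fun m => ‖lterm t χ x m‖) hs.norm ?_ ?_
    · intro m
      rw [← Filter.tendsto_add_atTop_iff_nat m]
      have h := (ratio_tendsto ht0 ht1 m).const_mul (lterm t χ x m)
      rw [mul_one] at h
      refine h.congr fun k => ?_
      have hm : m ∈ Finset.range (k+m+1) := Finset.mem_range.mpr (by omega)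
      simp only [g, if_pos hm, Nat.add_sub_cancel]
    · refine Filter.Eventually.of_forall fun n m => ?_
      simp only [g]
      split_ifs
      · rw [norm_mul]
        refine mul_le_of_le_one_right (norm_nonneg _) ?_
        have h1 := tP_pos ht0 ht1 n
        have h2 := tP_pos ht0 ht1 (n-m)
        rw [Real.norm_of_nonneg (by positivity), div_le_one h2]
        exact tP_anti ht0 ht1 (Nat.sub_le n m)
      · simp
  refine ge_of_tendsto' hlim fun n => ?_
  rw [hg]
  exact mul_nonneg (tP_pos ht0 ht1 n).le (Ff_nonneg ht0 ht1 n c hcp)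
end

section
/- For every real t with 0 < t < 1 and every real c > 0, the contour integral (1/2πi) ∫_{tG} e^{cw}/(−w;t)_∞ dw converges absolutely and equals (1/(t;t)_∞) Σ_{m=0}^{∞} e^{−c t^{−m}} (−1)^m t^{m(m−1)/2}/(t;t)_m. -/
open scoped BigOperators
open MeasureTheory

/-- The integrand `g(w) = e^{cw} / (-w;t)_∞`, where
`(-w;t)_∞ = ∏_{i≥0} (1 - (-w) t^i) = ∏_{i≥0} (1 + w t^i)`. -/
noncomputable def gInt (t c : ℝ) (w : ℂ) : ℂ :=
  Complex.exp ((c : ℂ) * w) / ∏' i : ℕ, (1 + w * (t : ℂ) ^ i)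

open Filter Topology

lemma aux_prodD (t : ℝ) (ht0 : 0 < t) (m k : ℕ) :
    ∏ j ∈ (Finset.range (m + 1 + k)).erase m, (1 - t ^ j / t ^ m) =
      (-1) ^ m * tPochN t m * tPochN t k / (t ^ (m * (m - 1) / 2) * t ^ m) := by
  have h1 : (Finset.range (m + 1 + k)).erase m =
      (Finset.range m).disjUnion ((Finset.range k).map (addLeftEmbedding (m + 1))) (by
        rw [Finset.disjoint_left]
        intro a ha hb
        simp at ha hb
        omega) := by
    ext a
    simp only [Finset.mem_erase, Finset.mem_range, Finset.mem_disjUnion, Finset.mem_map,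
      addLeftEmbedding_apply]
    constructor
    · rintro ⟨h, h'⟩
      by_cases h2 : a < m
      · exact Or.inl h2
      · exact Or.inr ⟨a - (m + 1), by omega, by omega⟩
    · rintro (h | ⟨b, hb, rfl⟩) <;> omega
  rw [h1, Finset.prod_disjUnion, Finset.prod_map]
  have h2 : ∏ x ∈ Finset.range k, (1 - t ^ (addLeftEmbedding (m + 1)) x / t ^ m) = tPochN t k := by
    unfold tPochN
    refine Finset.prod_congr rfl fun r _ => ?_
    simp only [addLeftEmbedding_apply]
    rw [show m + 1 + r = (r + 1) + m by ring, pow_add, mul_div_assoc, div_self (by positivity),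
      mul_one]
  rw [h2]
  have h3 : ∏ x ∈ Finset.range m, (1 - t ^ x / t ^ m) =
      (-1) ^ m * tPochN t m / (t ^ (m * (m - 1) / 2) * t ^ m) := by
    rw [← Finset.prod_range_reflect]
    have : ∀ r ∈ Finset.range m, (1 - t ^ (m - 1 - r) / t ^ m)
        = (-1) * (1 - t ^ (r + 1)) / (t ^ r * t) := by
      intro r hr
      rw [Finset.mem_range] at hr
      obtain ⟨s, rfl⟩ : ∃ s, m = s + r + 1 := ⟨m - r - 1, by omega⟩
      rw [show s + r + 1 - 1 - r = s by omega]
      have := pow_pos ht0 s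
      have := pow_pos ht0 r
      field_simp
      ring
    rw [Finset.prod_congr rfl this, Finset.prod_div_distrib, Finset.prod_mul_distrib,
      Finset.prod_mul_distrib, Finset.prod_pow_eq_pow_sum, Finset.sum_range_id]
    simp [tPochN]
  rw [h3]
  ring

lemma aux_N_pos (t : ℝ) (ht0 : 0 < t) (ht1 : t < 1) (n : ℕ) : 0 < tPochN t n :=
  Finset.prod_pos fun r _ => sub_pos.2 (pow_lt_one₀ ht0.le ht1 (by omega))

noncomputable def aux_coef (t : ℝ) (N m : ℕ) : ℝ :=
  (-1) ^ m * t ^ (m * (m - 1) / 2) / (tPochN t m * tPochN t (N - 1 - m))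

lemma aux_pf (t : ℝ) (ht0 : 0 < t) (ht1 : t < 1) (N : ℕ) (hN : 0 < N) (w : ℂ)
    (hw : ∀ m : ℕ, w + ((t ^ m)⁻¹ : ℝ) ≠ 0) :
    (∏ i ∈ Finset.range N, (1 + w * (t : ℂ) ^ i))⁻¹ =
      ∑ m ∈ Finset.range N, (aux_coef t N m : ℂ) * (w + ((t ^ m)⁻¹ : ℝ))⁻¹ := by
  have htc : (t : ℂ) ≠ 0 := by exact_mod_cast ht0.ne'
  have hinj : Set.InjOn (fun j : ℕ => -(((t ^ j)⁻¹ : ℝ) : ℂ)) (Finset.range N) := by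
    intro a _ b _ hab
    simp only [neg_inj, Complex.ofReal_inj, inv_inj] at hab
    exact (pow_right_injective₀ ht0 ht1.ne) hab
  have h := congrArg (Polynomial.eval w) (Lagrange.sum_basis hinj ⟨0, by simpa using hN⟩)
  simp only [Polynomial.eval_finsetSum, Polynomial.eval_one, Lagrange.basis,
    Polynomial.eval_prod, Lagrange.basisDivisor, Polynomial.eval_mul, Polynomial.eval_C,
    Polynomial.eval_sub, Polynomial.eval_X] at h
  have hf : ∀ i : ℕ, (1 + w * (t : ℂ) ^ i) = (t : ℂ) ^ i * (w + ((t ^ i)⁻¹ : ℝ)) := by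
    intro i
    have := pow_ne_zero i htc
    push_cast
    field_simp
    ring
  have hf0 : ∀ i : ℕ, (1 + w * (t : ℂ) ^ i) ≠ 0 := by
    intro i
    rw [hf]
    exact mul_ne_zero (pow_ne_zero i htc) (hw i)
  refine (mul_one _).symm.trans ((congrArg _ h.symm).trans ?_)
  rw [Finset.mul_sum]
  refine Finset.sum_congr rfl fun m hm => ?_
  have hm' := Finset.mem_range.1 hm
  have hD := aux_prodD t ht0 m (N - 1 - m)
  rw [show m + 1 + (N - 1 - m) = N by omega] at hD
  have hDc := congrArg (fun x : ℝ => (x : ℂ)) hD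
  push_cast at hDc
  have hterm : ∏ x ∈ (Finset.range N).erase m, ((-(((t ^ m)⁻¹ : ℝ) : ℂ) - -(((t ^ x)⁻¹ : ℝ) : ℂ))⁻¹ *
      (w - -(((t ^ x)⁻¹ : ℝ) : ℂ))) = (∏ x ∈ (Finset.range N).erase m, (1 - (t : ℂ) ^ x / (t : ℂ) ^ m))⁻¹
        * ∏ x ∈ (Finset.range N).erase m, (1 + w * (t : ℂ) ^ x) := by
    rw [← Finset.prod_inv_distrib, ← Finset.prod_mul_distrib]
    refine Finset.prod_congr rfl fun x hx => ?_
    rw [hf x]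
    have h1 := pow_ne_zero x htc
    have h2 := pow_ne_zero m htc
    have h3 : (1 - (t : ℂ) ^ x / (t : ℂ) ^ m) =
        (t : ℂ) ^ x * (-(((t ^ m)⁻¹ : ℝ) : ℂ) - -(((t ^ x)⁻¹ : ℝ) : ℂ)) := by
      push_cast
      field_simp
      ring
    rw [h3, mul_inv, sub_neg_eq_add w]
    field_simp
  rw [hterm, hDc, ← Finset.mul_prod_erase _ _ hm, hf m]
  have hE : ∏ x ∈ (Finset.range N).erase m, (1 + w * (t : ℂ) ^ x) ≠ 0 :=
    Finset.prod_ne_zero_iff.2 fun i _ => hf0 i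
  have h2 := pow_ne_zero m htc
  have h3 := hw m
  have h4 : (tPochN t m : ℂ) ≠ 0 := by exact_mod_cast (aux_N_pos t ht0 ht1 m).ne'
  have h5 : (tPochN t (N - 1 - m) : ℂ) ≠ 0 := by exact_mod_cast (aux_N_pos t ht0 ht1 _).ne'
  have h6 : ((-1 : ℂ) ^ m) * (-1) ^ m = 1 := by rw [← mul_pow]; simp
  have h7 := pow_ne_zero (m * (m - 1) / 2) htc
  have h8 : ((-1 : ℂ) ^ m) ≠ 0 := pow_ne_zero _ (by norm_num)
  unfold aux_coef
  push_cast at h3 ⊢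
  generalize (∏ x ∈ (Finset.range N).erase m, (1 + w * (t : ℂ) ^ x)) = E at *
  generalize (w + ((t : ℂ) ^ m)⁻¹) = u at *
  generalize (-1 : ℂ) ^ m = s at *
  field_simp
  linear_combination -h6
  
lemma aux_mult (t : ℝ) (ht0 : 0 < t) (ht1 : t < 1) :
    Tendsto (fun n => tPochN t n) atTop (𝓝 (tPochInf t)) ∧ 0 < tPochInf t ∧
      ∀ n, tPochInf t ≤ tPochN t n := by
  have hs : Summable fun r : ℕ => ‖-t ^ (r + 1)‖ := by
    simp only [norm_neg, norm_pow, Real.norm_eq_abs, abs_of_pos ht0]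
    exact (summable_nat_add_iff 1).2 (summable_geometric_of_lt_one ht0.le ht1)
  have hm := multipliable_one_add_of_summable hs
  have ht := hm.tendsto_prod_tprod_nat
  have hne := tprod_one_add_ne_zero_of_summable (f := fun r : ℕ => -t ^ (r + 1))
    (fun r => by
      have : t ^ (r + 1) < 1 := pow_lt_one₀ ht0.le ht1 (by omega)
      linarith) hs
  simp only [← sub_eq_add_neg] at ht hne
  have ht' : Tendsto (fun n => tPochN t n) atTop (𝓝 (tPochInf t)) := ht
  have hanti : Antitone (fun n => tPochN t n) := by
    refine antitone_nat_of_succ_le fun n => ?_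
    have := aux_N_pos t ht0 ht1 n
    have h2 : tPochN t (n + 1) = tPochN t n * (1 - t ^ (n + 1)) := Finset.prod_range_succ _ _
    have := pow_pos ht0 (n + 1)
    rw [h2]
    nlinarith
  refine ⟨ht', ?_, fun n => hanti.le_of_tendsto ht' n⟩
  exact lt_of_le_of_ne (ge_of_tendsto' ht' fun n => (aux_N_pos t ht0 ht1 n).le) (Ne.symm hne)

lemma aux_sum (t : ℝ) (ht0 : 0 < t) (ht1 : t < 1) :
    Summable fun m : ℕ => t ^ (m * (m - 1) / 2) := by
  refine Summable.of_nonneg_of_le (fun m => by positivity) (fun m => ?_)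
    ((summable_geometric_of_lt_one ht0.le ht1).mul_left t⁻¹)
  have h1 : m ≤ m * (m - 1) / 2 + 1 := by
    rcases m with _ | _ | m
    · simp
    · simp
    · have : 2 * (m + 1) ≤ (m + 1 + 1) * (m + 1 + 1 - 1) := by
        simp only [Nat.add_sub_cancel]; nlinarith
      have := Nat.div_le_div_right (c := 2) this
      omega
  rw [inv_mul_eq_div, le_div_iff₀ ht0, ← pow_succ]
  exact pow_le_pow_of_le_one ht0.le ht1.le h1

lemma aux_coef_le (t : ℝ) (ht0 : 0 < t) (ht1 : t < 1) (N m : ℕ) :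
    |aux_coef t N m| ≤ t ^ (m * (m - 1) / 2) * (tPochInf t ^ 2)⁻¹ := by
  obtain ⟨_, hp, hle⟩ := aux_mult t ht0 ht1
  unfold aux_coef
  have h1 := aux_N_pos t ht0 ht1 m
  have h2 := aux_N_pos t ht0 ht1 (N - 1 - m)
  rw [abs_div, abs_mul, abs_pow, abs_neg, abs_one, one_pow, one_mul,
    abs_of_pos (pow_pos ht0 _), abs_of_pos (mul_pos h1 h2), ← div_eq_mul_inv]
  have : tPochInf t ^ 2 ≤ tPochN t m * tPochN t (N - 1 - m) := by
    rw [sq]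
    exact mul_le_mul (hle _) (hle _) hp.le h1.le
  gcongr

def aux_S : Set ℂ := {w | (w.re ≤ 0 ∧ |w.im| = 1) ∨ (0 ≤ w.re ∧ ‖w‖ = 1)}

lemma aux_S_lo (x : ℝ) (hx : x ≤ 0) : (x - Complex.I : ℂ) ∈ aux_S := by
  left; simp [hx]

lemma aux_S_hi (x : ℝ) (hx : x ≤ 0) : (x + Complex.I : ℂ) ∈ aux_S := by
  left; simp [hx]

lemma aux_S_arc (θ : ℝ) (h : θ ∈ Set.Icc (-(Real.pi / 2)) (Real.pi / 2)) :
    Complex.exp (θ * Complex.I) ∈ aux_S := by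
  right
  refine ⟨?_, Complex.norm_exp_ofReal_mul_I θ⟩
  rw [Complex.exp_ofReal_mul_I_re]
  exact Real.cos_nonneg_of_mem_Icc h

lemma aux_S_le {w : ℂ} (hw : w ∈ aux_S) {a : ℝ} (ha : 1 ≤ a) : 1 ≤ ‖w + a‖ := by
  rcases hw with ⟨_, h⟩ | ⟨h, _⟩
  · have := Complex.abs_im_le_norm (w + a)
    simp at this
    linarith
  · have := Complex.re_le_norm (w + a)
    simp at this
    linarith

noncomputable def aux_CI (f : ℂ → ℂ) : ℂ :=
  (∫ x in Set.Iic (0 : ℝ), (f (x - Complex.I) - f (x + Complex.I))) +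
    ∫ θ in (-(Real.pi / 2))..(Real.pi / 2),
      f (Complex.exp (θ * Complex.I)) * Complex.I * Complex.exp (θ * Complex.I)

def aux_CInt (f : ℂ → ℂ) : Prop :=
  IntegrableOn (fun x : ℝ => f (x - Complex.I)) (Set.Iic 0) ∧
  IntegrableOn (fun x : ℝ => f (x + Complex.I)) (Set.Iic 0) ∧
  IntervalIntegrable
      (fun θ : ℝ => f (Complex.exp (θ * Complex.I)) * Complex.I *
        Complex.exp (θ * Complex.I)) volume (-(Real.pi / 2)) (Real.pi / 2)

lemma aux_CInt_of (c K : ℝ) (hc : 0 < c) (f : ℂ → ℂ) (hf : Measurable f)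
    (hb : ∀ w ∈ aux_S, ‖f w‖ ≤ K * Real.exp (c * w.re)) : aux_CInt f := by
  have hexp : IntegrableOn (fun x : ℝ => K * Real.exp (c * x)) (Set.Iic 0) :=
    (integrableOn_exp_mul_Iic hc 0).const_mul K
  refine ⟨?_, ?_, ?_⟩
  · refine Integrable.mono' hexp (hf.comp (by fun_prop)).aestronglyMeasurable ?_
    filter_upwards [ae_restrict_mem measurableSet_Iic] with x hx
    simpa using hb _ (aux_S_lo x hx)
  · refine Integrable.mono' hexp (hf.comp (by fun_prop)).aestronglyMeasurable ?_
    filter_upwards [ae_restrict_mem measurableSet_Iic] with x hx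
    simpa using hb _ (aux_S_hi x hx)
  · have h0 : IntervalIntegrable (fun θ : ℝ => K * Real.exp (c * Real.cos θ)) volume
        (-(Real.pi / 2)) (Real.pi / 2) := by
      apply Continuous.intervalIntegrable
      fun_prop
    refine h0.mono_fun' ?_ ?_
    · refine Measurable.aestronglyMeasurable ?_
      have : Measurable fun θ : ℝ => f (Complex.exp (θ * Complex.I)) := hf.comp (by fun_prop)
      fun_prop
    · rw [Set.uIoc_of_le (by linarith [Real.pi_pos])]
      filter_upwards [ae_restrict_mem measurableSet_Ioc] with x hx
      have := hb _ (aux_S_arc x ⟨hx.1.le, hx.2⟩)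
      rw [Complex.exp_ofReal_mul_I_re] at this
      simpa [Complex.norm_exp_ofReal_mul_I] using this

lemma aux_CI_tendsto (c K : ℝ) (hc : 0 < c) (F : ℕ → ℂ → ℂ) (f : ℂ → ℂ)
    (hF : ∀ n, Measurable (F n))
    (hb : ∀ n, ∀ w ∈ aux_S, ‖F n w‖ ≤ K * Real.exp (c * w.re))
    (hlim : ∀ w ∈ aux_S, Tendsto (fun n => F n w) atTop (𝓝 (f w))) :
    Tendsto (fun n => aux_CI (F n)) atTop (𝓝 (aux_CI f)) := by
  have hexp : IntegrableOn (fun x : ℝ => K * Real.exp (c * x) + K * Real.exp (c * x)) (Set.Iic 0) :=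
    ((integrableOn_exp_mul_Iic hc 0).const_mul K).add ((integrableOn_exp_mul_Iic hc 0).const_mul K)
  refine Tendsto.add ?_ ?_
  · refine tendsto_integral_of_dominated_convergence _ ?_ hexp ?_ ?_
    · intro n
      exact (((hF n).comp (by fun_prop : Measurable fun x : ℝ => (x - Complex.I : ℂ))).sub
        ((hF n).comp (by fun_prop : Measurable fun x : ℝ => (x + Complex.I : ℂ)))).aestronglyMeasurable
    · intro n
      filter_upwards [ae_restrict_mem measurableSet_Iic] with x hx
      refine (norm_sub_le _ _).trans (add_le_add ?_ ?_)
      · simpa using hb n _ (aux_S_lo x hx)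
      · simpa using hb n _ (aux_S_hi x hx)
    · filter_upwards [ae_restrict_mem measurableSet_Iic] with x hx
      exact (hlim _ (aux_S_lo x hx)).sub (hlim _ (aux_S_hi x hx))
  · have h0 : IntervalIntegrable (fun θ : ℝ => K * Real.exp (c * Real.cos θ)) volume
        (-(Real.pi / 2)) (Real.pi / 2) := by
      apply Continuous.intervalIntegrable
      fun_prop
    refine intervalIntegral.tendsto_integral_filter_of_dominated_convergence _ ?_ ?_ h0 ?_
    · refine Eventually.of_forall fun n => Measurable.aestronglyMeasurable ?_
      have : Measurable fun θ : ℝ => F n (Complex.exp (θ * Complex.I)) := (hF n).comp (by fun_prop)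
      fun_prop
    · refine Eventually.of_forall fun n => Eventually.of_forall fun x hx => ?_
      rw [Set.uIoc_of_le (by linarith [Real.pi_pos])] at hx
      have := hb n _ (aux_S_arc x ⟨hx.1.le, hx.2⟩)
      rw [Complex.exp_ofReal_mul_I_re] at this
      simpa [Complex.norm_exp_ofReal_mul_I] using this
    · refine Eventually.of_forall fun x hx => ?_
      rw [Set.uIoc_of_le (by linarith [Real.pi_pos])] at hx
      exact ((hlim _ (aux_S_arc x ⟨hx.1.le, hx.2⟩)).mul_const _).mul_const _

lemma aux_CI_sum (s : Finset ℕ) (A : ℕ → ℂ) (h : ℕ → ℂ → ℂ) (hi : ∀ m, aux_CInt (h m)) :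
    aux_CI (fun w => ∑ m ∈ s, A m * h m w) = ∑ m ∈ s, A m * aux_CI (h m) := by
  unfold aux_CI
  simp only [← Finset.sum_sub_distrib, ← mul_sub, Finset.sum_mul, mul_add, Finset.sum_add_distrib]
  congr 1
  · rw [integral_finsetSum]
    · simp only [integral_const_mul]
    · exact fun m _ => ((hi m).1.sub (hi m).2.1).const_mul _
  · rw [intervalIntegral.integral_finsetSum]
    · simp only [mul_assoc, intervalIntegral.integral_const_mul]
    · intro m _
      simpa only [mul_assoc] using (hi m).2.2.const_mul (A m)

noncomputable def aux_h (c a : ℝ) (w : ℂ) : ℂ := Complex.exp (c * w) * (w + a)⁻¹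

lemma aux_h_meas (c a : ℝ) : Measurable (aux_h c a) := by
  unfold aux_h; fun_prop

lemma aux_h_bd (c a : ℝ) (ha : 1 ≤ a) (w : ℂ) (hw : w ∈ aux_S) :
    ‖aux_h c a w‖ ≤ 1 * Real.exp (c * w.re) := by
  unfold aux_h
  rw [norm_mul, norm_inv, Complex.norm_exp, mul_comm]
  have := aux_S_le hw ha
  have h2 : (c * w : ℂ).re = c * w.re := by simp
  rw [h2]
  gcongr
  exact inv_le_one_of_one_le₀ this

lemma aux_h_int (c a : ℝ) (hc : 0 < c) (ha : 1 ≤ a) : aux_CInt (aux_h c a) :=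
  aux_CInt_of c 1 hc _ (aux_h_meas c a) (aux_h_bd c a ha)

lemma aux_prim (c : ℝ) : ∃ G : ℂ → ℂ, ∀ z ≠ 0,
    HasDerivAt G ((Complex.exp (c * z) - 1) / z) z := by
  have hd : Differentiable ℂ (dslope (fun z : ℂ => Complex.exp (c * z)) 0) := by
    rw [← differentiableOn_univ, Complex.differentiableOn_dslope Filter.univ_mem]
    exact Differentiable.differentiableOn (by fun_prop)
  obtain ⟨G, hG⟩ := hd.isExactOn_univ
  refine ⟨G, fun z hz => ?_⟩
  refine (hG z (Set.mem_univ z)).congr_deriv ?_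
  rw [dslope_of_ne _ hz, slope_def_field]
  simp

lemma aux_arg (a : ℝ) : Tendsto (fun R : ℝ => Complex.log (-R + a + Complex.I) -
    Complex.log (-R + a - Complex.I)) atTop (𝓝 (2 * Real.pi * Complex.I)) := by
  have h1 : Tendsto (fun R : ℝ => Complex.arg (-1 + ((R - a)⁻¹ : ℝ) * Complex.I)) atTop
      (𝓝 Real.pi) := by
    have h := Complex.continuousWithinAt_arg_of_re_neg_of_im_zero (z := -1) (by simp) (by simp)
    have h' := h.tendsto
    rw [Complex.arg_neg_one] at h'
    refine h'.comp (tendsto_nhdsWithin_iff.2 ⟨?_, ?_⟩)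
    · have h2 : Tendsto (fun R : ℝ => (R - a)⁻¹) atTop (𝓝 0) :=
        tendsto_inv_atTop_zero.comp (tendsto_atTop_add_const_right _ _ tendsto_id)
      have h3 := (Complex.continuous_ofReal.tendsto 0).comp h2
      simpa using (h3.mul_const Complex.I).const_add (-1)
    · filter_upwards [eventually_gt_atTop a] with R hR
      have : 0 ≤ (R - a)⁻¹ := inv_nonneg.2 (sub_pos.2 hR).le
      change 0 ≤ (-1 + ((R - a)⁻¹ : ℝ) * Complex.I : ℂ).im
      rw [Complex.add_im, Complex.im_ofReal_mul]
      simpa using this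
  have h4 : Tendsto (fun R : ℝ => 2 *
      (Complex.arg (-1 + ((R - a)⁻¹ : ℝ) * Complex.I) : ℂ) * Complex.I) atTop
      (𝓝 (2 * Real.pi * Complex.I)) :=
    (((Complex.continuous_ofReal.tendsto _).comp h1).const_mul 2).mul_const _
  refine h4.congr' ?_
  filter_upwards [eventually_gt_atTop a] with R hR
  have e1 : (-R + a + Complex.I : ℂ) = ((R - a : ℝ) : ℂ) * (-1 + ((R - a)⁻¹ : ℝ) * Complex.I) := by
    have : ((R - a : ℝ) : ℂ) ≠ 0 := by exact_mod_cast (sub_pos.2 hR).ne'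
    rw [Complex.ofReal_inv]
    field_simp
    push_cast
    ring
  have e2 : (-R + a - Complex.I : ℂ) = (starRingEnd ℂ) (-R + a + Complex.I) := by
    simp [sub_eq_add_neg]
  have e3 : Complex.arg (-R + a + Complex.I) = Complex.arg (-1 + ((R - a)⁻¹ : ℝ) * Complex.I) := by
    rw [e1, Complex.arg_real_mul _ (sub_pos.2 hR)]
  rw [e2, Complex.log_conj, Complex.sub_conj, Complex.log_im, e3]
  · push_cast; ring
  · intro h
    have := (Complex.arg_eq_pi_iff.1 h).2
    simp at this

lemma aux_Gdiff (c a : ℝ) (hc : 0 < c) (G : ℂ → ℂ) (hG : ∀ z ≠ 0,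
    HasDerivAt G ((Complex.exp (c * z) - 1) / z) z) :
    Tendsto (fun R : ℝ => G (-R + a + Complex.I) - G (-R + a - Complex.I)) atTop (𝓝 0) := by
  have hlim : Tendsto (fun R : ℝ => 2 / (R - a) * 2) atTop (𝓝 0) := by
    have h2 : Tendsto (fun R : ℝ => (R - a)⁻¹) atTop (𝓝 0) :=
      tendsto_inv_atTop_zero.comp (tendsto_atTop_add_const_right _ _ tendsto_id)
    simpa [div_eq_mul_inv] using (h2.const_mul 2).mul_const 2
  refine squeeze_zero_norm' ?_ hlim
  filter_upwards [eventually_gt_atTop a] with R hR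
  have hR' := sub_pos.2 hR
  have hconv : Convex ℝ {z : ℂ | z.re = a - R} := by
    intro x hx y hy p q _ _ hpq
    simp only [Set.mem_ofPred_eq] at *
    simp [hx, hy, ← add_mul, hpq]
  have hne : ∀ z ∈ {z : ℂ | z.re = a - R}, z ≠ 0 := by
    rintro z hz rfl
    simp at hz
    linarith
  have := hconv.norm_image_sub_le_of_norm_hasDerivWithin_le (f := G) (C := 2 / (R - a))
    (x := -R + a - Complex.I) (y := -R + a + Complex.I)
    (fun z hz => (hG z (hne z hz)).hasDerivWithinAt) ?_ ?_ ?_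
  · have e : ((-R + a + Complex.I : ℂ) - (-R + a - Complex.I)) = 2 * Complex.I := by ring
    rw [e] at this
    simpa using this
  · intro z hz
    rw [norm_div]
    have hz' : z.re = a - R := hz
    have h1 : R - a ≤ ‖z‖ := by
      have := Complex.abs_re_le_norm z
      rw [hz', abs_sub_comm, abs_of_pos hR'] at this
      exact this
    have h2 : ‖Complex.exp (c * z) - 1‖ ≤ 2 := by
      refine (norm_sub_le _ _).trans ?_
      rw [Complex.norm_exp]
      have : (c * z : ℂ).re ≤ 0 := by
        simp [hz']
        nlinarith
      have := Real.exp_le_one_iff.2 this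
      rw [norm_one]
      linarith
    gcongr
  · simp; ring
  · simp; ring

lemma aux_h_CI (c a : ℝ) (hc : 0 < c) (ha : 1 ≤ a) :
    aux_CI (aux_h c a) = 2 * Real.pi * Complex.I * Complex.exp (-(c * a)) := by
  obtain ⟨G, hG⟩ := aux_prim c
  set Φ : ℂ → ℂ := fun w => Complex.exp (-(c * a)) * (G (w + a) + Complex.log (w + a)) with hΦ
  have hd : ∀ w : ℂ, w + a ∈ Complex.slitPlane → HasDerivAt Φ (aux_h c a w) w := by
    intro w hw
    have hne := Complex.slitPlane_ne_zero hw
    have h1 : HasDerivAt (fun w : ℂ => w + a) 1 w := (hasDerivAt_id w).add_const _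
    have h2 := ((HasDerivAt.comp w (hG _ hne) h1).add
      (HasDerivAt.comp w (Complex.hasDerivAt_log hw) h1)).const_mul (Complex.exp (-(c * a)))
    refine h2.congr_deriv ?_
    unfold aux_h
    have : Complex.exp (c * w) = Complex.exp (-(c * a)) * Complex.exp (c * (w + a)) := by
      rw [← Complex.exp_add]; congr 1; ring
    rw [this]
    field_simp
    ring
  have hlo : ∀ x : ℝ, ((x - Complex.I : ℂ) + a) ∈ Complex.slitPlane := fun x => by
    rw [Complex.mem_slitPlane_iff]; right; simp
  have hhi : ∀ x : ℝ, ((x + Complex.I : ℂ) + a) ∈ Complex.slitPlane := fun x => by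
    rw [Complex.mem_slitPlane_iff]; right; simp
  obtain ⟨i1, i2, i3⟩ := aux_h_int c a hc ha
  have harc : ∫ θ in (-(Real.pi / 2))..(Real.pi / 2),
      aux_h c a (Complex.exp (θ * Complex.I)) * Complex.I * Complex.exp (θ * Complex.I) =
      Φ Complex.I - Φ (-Complex.I) := by
    rw [intervalIntegral.integral_eq_sub_of_hasDerivAt
      (f := fun θ : ℝ => Φ (Complex.exp (θ * Complex.I))) ?_ i3]
    · congr 2
      · push_cast; exact Complex.exp_pi_div_two_mul_I
      · push_cast
        rw [neg_mul, Complex.exp_neg, Complex.exp_pi_div_two_mul_I, Complex.inv_I]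
    · intro θ hθ
      rw [Set.uIcc_of_le (by linarith [Real.pi_pos])] at hθ
      have hs : Complex.exp (θ * Complex.I) + a ∈ Complex.slitPlane := by
        rw [Complex.mem_slitPlane_iff]; left
        have := Real.cos_nonneg_of_mem_Icc hθ
        rw [Complex.add_re, Complex.exp_ofReal_mul_I_re, Complex.ofReal_re]
        linarith
      have h1 : HasDerivAt (fun θ : ℝ => Complex.exp (θ * Complex.I))
          (Complex.exp (θ * Complex.I) * Complex.I) θ := by
        have := ((hasDerivAt_id (θ : ℂ)).mul_const Complex.I).cexp.comp_ofReal
        simpa using this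
      have h2 := HasDerivAt.comp θ (hd _ hs) h1
      refine h2.congr_deriv ?_
      ring
  have hray : ∀ R : ℝ, ∫ x in (-R)..0, (aux_h c a (x - Complex.I) - aux_h c a (x + Complex.I)) =
      (Φ (-Complex.I) - Φ (Complex.I)) - (Φ (-R - Complex.I) - Φ (-R + Complex.I)) := by
    intro R
    have hder : ∀ x : ℝ, HasDerivAt (fun x : ℝ => Φ (x - Complex.I) - Φ (x + Complex.I))
        (aux_h c a (x - Complex.I) - aux_h c a (x + Complex.I)) x := by
      intro x
      have h1 : HasDerivAt (fun x : ℝ => (x - Complex.I : ℂ)) 1 x :=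
        ((hasDerivAt_id (x : ℂ)).sub_const Complex.I).comp_ofReal
      have h2 : HasDerivAt (fun x : ℝ => (x + Complex.I : ℂ)) 1 x :=
        ((hasDerivAt_id (x : ℂ)).add_const Complex.I).comp_ofReal
      have h3 := (HasDerivAt.comp x (hd _ (hlo x)) h1).sub (HasDerivAt.comp x (hd _ (hhi x)) h2)
      refine h3.congr_deriv ?_
      ring
    have hci : Continuous fun x : ℝ => aux_h c a (x - Complex.I) - aux_h c a (x + Complex.I) := by
      unfold aux_h
      have n1 : ∀ x : ℝ, ((x - Complex.I : ℂ) + a) ≠ 0 := fun x => Complex.slitPlane_ne_zero (hlo x)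
      have n2 : ∀ x : ℝ, ((x + Complex.I : ℂ) + a) ≠ 0 := fun x => Complex.slitPlane_ne_zero (hhi x)
      fun_prop (disch := assumption)
    rw [intervalIntegral.integral_eq_sub_of_hasDerivAt (fun x _ => hder x)
      (hci.intervalIntegrable _ _)]
    simp
  have hT := intervalIntegral_tendsto_integral_Iic (0 : ℝ) (i1.sub i2) tendsto_neg_atTop_atBot
  have hT2 := ((aux_Gdiff c a hc G hG).add (aux_arg a)).const_mul (Complex.exp (-(c * a)))
  have hT3 := hT.add_const (Φ Complex.I - Φ (-Complex.I))
  unfold aux_CI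
  rw [harc]
  refine (tendsto_nhds_unique hT3 ((hT2.congr fun R => ?_))).trans ?_
  · have := hray R
    simp only [Pi.sub_apply]
    rw [this, hΦ]
    simp only
    rw [show (-R + Complex.I + a : ℂ) = -R + a + Complex.I by ring,
      show (-R - Complex.I + a : ℂ) = -R + a - Complex.I by ring]
    ring
  · ring

lemma aux_final (t c : ℝ) (ht0 : 0 < t) (ht1 : t < 1) (hc : 0 < c) :
    aux_CInt (gInt t c) ∧ (2 * (Real.pi : ℂ) * Complex.I)⁻¹ * aux_CI (gInt t c) =
      ((tPochInf t : ℝ) : ℂ)⁻¹ *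
        ∑' m : ℕ, ((Real.exp (-c * t ^ (-(m : ℤ))) : ℝ) : ℂ) * (-1) ^ m *
          (t : ℂ) ^ (m * (m - 1) / 2) / ((tPochN t m : ℝ) : ℂ) := by
  obtain ⟨hP, hPpos, hPle⟩ := aux_mult t ht0 ht1
  have hsum := aux_sum t ht0 ht1
  have ha : ∀ m : ℕ, 1 ≤ (t ^ m)⁻¹ := fun m =>
    (one_le_inv₀ (pow_pos ht0 m)).2 (pow_le_one₀ ht0.le ht1.le)
  set B : ℕ → ℝ := fun m => t ^ (m * (m - 1) / 2) * (tPochInf t ^ 2)⁻¹ with hB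
  have hBs : Summable B := hsum.mul_right _
  have hB0 : ∀ m, 0 ≤ B m := fun m => by positivity
  set K : ℝ := ∑' m, B m with hK
  set F : ℕ → ℂ → ℂ := fun N w =>
    ∑ m ∈ Finset.range (N + 1), (aux_coef t (N + 1) m : ℂ) * aux_h c (t ^ m)⁻¹ w with hF
  have hFm : ∀ n, Measurable (F n) := fun n =>
    Finset.measurable_fun_sum _ fun m _ => (aux_h_meas c _).const_mul _
  have hFb : ∀ n, ∀ w ∈ aux_S, ‖F n w‖ ≤ K * Real.exp (c * w.re) := by
    intro n w hw
    refine (norm_sum_le _ _).trans ?_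
    calc ∑ m ∈ Finset.range (n + 1), ‖(aux_coef t (n + 1) m : ℂ) * aux_h c (t ^ m)⁻¹ w‖
        ≤ ∑ m ∈ Finset.range (n + 1), B m * Real.exp (c * w.re) := by
          refine Finset.sum_le_sum fun m _ => ?_
          rw [norm_mul, Complex.norm_real, Real.norm_eq_abs]
          refine mul_le_mul (aux_coef_le t ht0 ht1 _ _) ?_ (norm_nonneg _) (hB0 m)
          simpa using aux_h_bd c _ (ha m) w hw
      _ ≤ _ := by
          rw [← Finset.sum_mul]
          exact mul_le_mul_of_nonneg_right (hBs.sum_le_tsum _ fun m _ => hB0 m)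
            (Real.exp_pos _).le
  have hprod : ∀ w : ℂ, Tendsto (fun n => ∏ i ∈ Finset.range n, (1 + w * (t : ℂ) ^ i)) atTop
      (𝓝 (∏' i : ℕ, (1 + w * (t : ℂ) ^ i))) ∧
      ((∀ i : ℕ, 1 + w * (t : ℂ) ^ i ≠ 0) → ∏' i : ℕ, (1 + w * (t : ℂ) ^ i) ≠ 0) := by
    intro w
    have hs : Summable fun i : ℕ => ‖w * (t : ℂ) ^ i‖ := by
      simp only [norm_mul, norm_pow, Complex.norm_real, Real.norm_eq_abs, abs_of_pos ht0]
      exact (summable_geometric_of_lt_one ht0.le ht1).mul_left _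
    exact ⟨(multipliable_one_add_of_summable hs).tendsto_prod_tprod_nat,
      fun h => tprod_one_add_ne_zero_of_summable h hs⟩
  have hgm : Measurable (gInt t c) := by
    have : Measurable fun w : ℂ => ∏' i : ℕ, (1 + w * (t : ℂ) ^ i) :=
      measurable_of_tendsto_metrizable
        (f := fun n (w : ℂ) => ∏ i ∈ Finset.range n, (1 + w * (t : ℂ) ^ i))
        (fun n => Finset.measurable_fun_prod _ fun i _ => by fun_prop)
        (tendsto_pi_nhds.2 fun w => (hprod w).1)
    unfold gInt
    fun_prop
  have hlim : ∀ w ∈ aux_S, Tendsto (fun n => F n w) atTop (𝓝 (gInt t c w)) := by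
    intro w hw
    have hw0 : ∀ m : ℕ, w + ((t ^ m)⁻¹ : ℝ) ≠ 0 := by
      intro m h
      have := aux_S_le hw (ha m)
      rw [h, norm_zero] at this
      linarith
    have htc : (t : ℂ) ≠ 0 := by exact_mod_cast ht0.ne'
    have hf0 : ∀ i : ℕ, (1 + w * (t : ℂ) ^ i) ≠ 0 := by
      intro i h
      apply hw0 i
      have := pow_ne_zero i htc
      push_cast
      field_simp
      linear_combination h
    have h1 := (((hprod w).1.inv₀ ((hprod w).2 hf0)).const_mul (Complex.exp (c * w))).comp
      (tendsto_add_atTop_nat 1)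
    refine (h1.congr fun n => ?_)
    simp only [Function.comp_apply, hF]
    rw [aux_pf t ht0 ht1 (n + 1) (by omega) w hw0, Finset.mul_sum]
    refine Finset.sum_congr rfl fun m _ => ?_
    unfold aux_h
    ring
  refine ⟨aux_CInt_of c K hc _ hgm fun w hw =>
    le_of_tendsto' (hlim w hw).norm fun n => hFb n w hw, ?_⟩
  have hCI := (aux_CI_tendsto c K hc F _ hFm hFb hlim).const_mul (2 * (Real.pi : ℂ) * Complex.I)⁻¹
  refine tendsto_nhds_unique hCI ?_
  have hpi : (2 * (Real.pi : ℂ) * Complex.I) ≠ 0 := Complex.two_pi_I_ne_zero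
  set T : ℕ → ℕ → ℂ := fun n m => if m < n + 1 then
    (aux_coef t (n + 1) m : ℂ) * Complex.exp (-(c * ((t ^ m)⁻¹ : ℝ))) else 0 with hT
  have hval : ∀ n, (2 * (Real.pi : ℂ) * Complex.I)⁻¹ * aux_CI (F n) = ∑' m, T n m := by
    intro n
    rw [hF, aux_CI_sum _ _ _ fun m => aux_h_int c _ hc (ha m),
      tsum_eq_sum (s := Finset.range (n + 1)), Finset.mul_sum]
    · refine Finset.sum_congr rfl fun m hm => ?_
      rw [hT]
      simp only [if_pos (Finset.mem_range.1 hm)]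
      rw [aux_h_CI c _ hc (ha m)]
      field_simp
    · intro m hm
      rw [Finset.mem_range] at hm
      simp only [hT, if_neg hm]
  simp only [hval]
  rw [← tsum_mul_left]
  refine tendsto_tsum_of_dominated_convergence hBs ?_ ?_
  · intro m
    have h1 : Tendsto (fun n => tPochN t (n + 1 - 1 - m)) atTop (𝓝 (tPochInf t)) := by
      simp only [Nat.add_sub_cancel]
      exact hP.comp (tendsto_sub_atTop_nat m)
    have h2 : Tendsto (fun n => aux_coef t (n + 1) m) atTop
        (𝓝 ((-1) ^ m * t ^ (m * (m - 1) / 2) / (tPochN t m * tPochInf t))) :=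
      Tendsto.div tendsto_const_nhds (h1.const_mul _)
        (mul_pos (aux_N_pos t ht0 ht1 m) hPpos).ne'
    have h3 := ((Complex.continuous_ofReal.tendsto _).comp h2).mul_const
      (Complex.exp (-(c * ((t ^ m)⁻¹ : ℝ))))
    have h4 : ((((-1) ^ m * t ^ (m * (m - 1) / 2) / (tPochN t m * tPochInf t) : ℝ)) : ℂ) *
        Complex.exp (-(c * ((t ^ m)⁻¹ : ℝ))) =
        ((tPochInf t : ℝ) : ℂ)⁻¹ * (((Real.exp (-c * t ^ (-(m : ℤ))) : ℝ) : ℂ) * (-1) ^ m *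
          (t : ℂ) ^ (m * (m - 1) / 2) / ((tPochN t m : ℝ) : ℂ)) := by
      rw [zpow_neg, zpow_natCast]
      push_cast
      rw [neg_mul, div_eq_mul_inv, div_eq_mul_inv, mul_inv]
      ring
    rw [← h4]
    refine h3.congr' ?_
    filter_upwards [eventually_ge_atTop m] with n hn
    simp only [hT, if_pos (show m < n + 1 by omega), Function.comp_apply]
  · refine Eventually.of_forall fun n m => ?_
    simp only [hT]
    split_ifs
    · rw [norm_mul, Complex.norm_real, Real.norm_eq_abs, Complex.norm_exp]
      refine (mul_le_of_le_one_right (abs_nonneg _) ?_).trans (aux_coef_le t ht0 ht1 _ _)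
      rw [Real.exp_le_one_iff, ← Complex.ofReal_mul, ← Complex.ofReal_neg, Complex.ofReal_re]
      have := mul_pos hc (zero_lt_one.trans_le (ha m))
      linarith
    · simpa using hB0 m

theorem stmt3 (t c : ℝ) (ht0 : 0 < t) (ht1 : t < 1) (hc : 0 < c) :
    IntegrableOn (fun x : ℝ => gInt t c (x - Complex.I)) (Set.Iic 0) ∧
    IntegrableOn (fun x : ℝ => gInt t c (x + Complex.I)) (Set.Iic 0) ∧
    IntervalIntegrable
      (fun θ : ℝ => gInt t c (Complex.exp (θ * Complex.I)) * Complex.I *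
        Complex.exp (θ * Complex.I)) volume (-(Real.pi / 2)) (Real.pi / 2) ∧
    (2 * (Real.pi : ℂ) * Complex.I)⁻¹ *
        ((∫ x in Set.Iic (0 : ℝ),
            (gInt t c (x - Complex.I) - gInt t c (x + Complex.I))) +
          ∫ θ in (-(Real.pi / 2))..(Real.pi / 2),
            gInt t c (Complex.exp (θ * Complex.I)) * Complex.I *
              Complex.exp (θ * Complex.I)) =
      ((tPochInf t : ℝ) : ℂ)⁻¹ *
        ∑' m : ℕ, ((Real.exp (-c * t ^ (-(m : ℤ))) : ℝ) : ℂ) * (-1) ^ m *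
          (t : ℂ) ^ (m * (m - 1) / 2) / ((tPochN t m : ℝ) : ℂ) := by
  obtain ⟨⟨h1, h2, h3⟩, h4⟩ := aux_final t c ht0 ht1 hc
  exact ⟨h1, h2, h3, h4⟩
end

section
/- Let t be real with 0 < t < 1 and let m be an integer. The meromorphic function h(w) = 1/(w (−w^{−1};t)_∞ (−tw;t)_∞) has a simple pole at w = −t^m, and lim_{w → −t^m} (w + t^m) h(w) = (−1)^m t^{m(m+1)/2} / (t;t)_∞^2. -/
open scoped BigOperators Topology

/-- `h(w) = 1 / (w (-w⁻¹;t)_∞ (-tw;t)_∞)`, where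
`(-w⁻¹;t)_∞ = ∏_{i≥0}(1 + w⁻¹ t^i)` and `(-tw;t)_∞ = ∏_{i≥0}(1 + t w t^i)`. -/
noncomputable def polefn (t : ℝ) (w : ℂ) : ℂ :=
  1 / (w * (∏' i : ℕ, (1 + w⁻¹ * (t : ℂ) ^ i)) * (∏' i : ℕ, (1 + (t : ℂ) * w * (t : ℂ) ^ i)))

noncomputable def PP (t : ℝ) (a : ℂ) : ℂ := ∏' i : ℕ, (1 + a * (t : ℂ) ^ i)

lemma PP_summable (t : ℝ) (ht0 : 0 < t) (ht1 : t < 1) (a : ℂ) :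
    Summable (fun i : ℕ => ‖a * (t : ℂ) ^ i‖) := by
  simp only [norm_mul, norm_pow, Complex.norm_real, Real.norm_of_nonneg ht0.le]
  exact (summable_geometric_of_lt_one ht0.le ht1).mul_left _

lemma PP_mul (t : ℝ) (ht0 : 0 < t) (ht1 : t < 1) (a : ℂ) :
    PP t a = (1 + a) * PP t (t * a) := by
  have hm : Multipliable (fun i : ℕ => 1 + (t * a) * (t : ℂ) ^ i) :=
    multipliable_one_add_of_summable (PP_summable t ht0 ht1 _)
  have := hm.hasProd
  have h2 : HasProd (fun i : ℕ => 1 + a * (t : ℂ) ^ (i + 1)) (PP t (t * a)) := by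
    unfold PP
    convert this using 3
    ring
  have h3 := h2.zero_mul (f := fun i : ℕ => 1 + a * (t : ℂ) ^ i)
  have h4 := h3.tprod_eq
  simp only [pow_zero, mul_one] at h4
  exact h4

lemma PP_cont (t : ℝ) (ht0 : 0 < t) (ht1 : t < 1) : Continuous (PP t) := by
  rw [continuous_iff_continuousAt]
  intro a
  unfold ContinuousAt PP
  refine tendsto_tprod_one_add_of_dominated_convergence
    (bound := fun i : ℕ => (‖a‖ + 1) * t ^ i) ?_ ?_ ?_
  · exact (summable_geometric_of_lt_one ht0.le ht1).mul_left _
  · intro i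
    exact (Continuous.tendsto (by fun_prop) a)
  · filter_upwards [Metric.ball_mem_nhds a one_pos] with w hw i
    simp only [norm_mul, norm_pow, Complex.norm_real, Real.norm_of_nonneg ht0.le]
    gcongr
    have : ‖w - a‖ < 1 := by simpa [dist_eq_norm] using hw
    have := norm_sub_norm_le w a
    linarith

lemma PP_neg (t : ℝ) (ht0 : 0 < t) (ht1 : t < 1) : PP t (-t) = ((tPochInf t : ℝ) : ℂ) := by
  have hm : Multipliable (fun i : ℕ => 1 + -t ^ (i + 1)) := by
    apply multipliable_one_add_of_summable
    simp only [norm_neg, norm_pow, Real.norm_of_nonneg ht0.le]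
    exact (summable_nat_add_iff 1).2 (summable_geometric_of_lt_one ht0.le ht1)
  have h := hm.hasProd.map Complex.ofRealHom Complex.continuous_ofReal
  have h' := h.tprod_eq
  unfold PP tPochInf
  simp only [sub_eq_add_neg]
  refine Eq.trans ?_ h'
  refine tprod_congr fun i => ?_
  simp
  ring

lemma PP_neg_ne (t : ℝ) (ht0 : 0 < t) (ht1 : t < 1) : PP t (-t) ≠ 0 := by
  unfold PP
  refine tprod_one_add_ne_zero_of_summable (fun i => ?_) (PP_summable t ht0 ht1 _)
  have h : t ^ (i + 1) < 1 := pow_lt_one₀ ht0.le ht1 (by simp)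
  intro h0
  have : ((1 - t ^ (i + 1) : ℝ) : ℂ) = 0 := by
    rw [← h0]; push_cast; ring
  have := Complex.ofReal_eq_zero.1 this
  linarith

lemma polefn_eq (t : ℝ) (w : ℂ) : polefn t w = 1 / (w * PP t w⁻¹ * PP t (t * w)) := rfl

lemma polefn_t (t : ℝ) (ht0 : 0 < t) (ht1 : t < 1) (w : ℂ) (hw : w ≠ 0) :
    polefn t (t * w) = w * polefn t w := by
  have ht : (t : ℂ) ≠ 0 := by exact_mod_cast ht0.ne'
  have h1 := PP_mul t ht0 ht1 ((t * w)⁻¹)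
  have h2 := PP_mul t ht0 ht1 (t * w)
  have e : (t : ℂ) * (t * w)⁻¹ = w⁻¹ := by field_simp
  rw [e] at h1
  have key : t * w * PP t (t * w)⁻¹ * PP t (t * (t * w)) = PP t w⁻¹ * PP t (t * w) := by
    rw [h1, h2]; field_simp; ring
  rw [polefn_eq, polefn_eq, key]
  rw [mul_assoc w, one_div, one_div, mul_inv w, mul_inv_cancel_left₀ hw]

lemma base (t : ℝ) (ht0 : 0 < t) (ht1 : t < 1) :
    Filter.Tendsto (fun w : ℂ => (w + 1) * polefn t w) (𝓝[≠] (-1))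
      (𝓝 (1 / ((tPochInf t : ℝ) : ℂ) ^ 2)) := by
  have hc : Filter.Tendsto (fun w : ℂ => 1 / (PP t (t * w⁻¹) * PP t (t * w))) (𝓝 (-1))
      (𝓝 (1 / (PP t (t * (-1)⁻¹) * PP t (t * (-1))))) := by
    have hi : Filter.Tendsto (fun w : ℂ => w⁻¹) (𝓝 (-1)) (𝓝 (-1)⁻¹) :=
      tendsto_inv₀ (by norm_num)
    have c := PP_cont t ht0 ht1
    have hn := PP_neg_ne t ht0 ht1
    refine Filter.Tendsto.div tendsto_const_nhds (Filter.Tendsto.mul ?_ ?_) ?_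
    · exact (c.tendsto _).comp (hi.const_mul _)
    · exact (c.tendsto _).comp (Filter.tendsto_id.const_mul _)
    · have : (-1 : ℂ)⁻¹ = -1 := by norm_num
      rw [this, mul_neg_one]
      exact mul_ne_zero hn hn
  have e : (1 / (PP t (t * (-1)⁻¹) * PP t (t * (-1)))) = 1 / ((tPochInf t : ℝ) : ℂ) ^ 2 := by
    have : (-1 : ℂ)⁻¹ = -1 := by norm_num
    rw [this, mul_neg_one, PP_neg t ht0 ht1, sq]
  rw [e] at hc
  refine (hc.mono_left nhdsWithin_le_nhds).congr' ?_
  have h0 : ∀ᶠ w : ℂ in 𝓝[≠] (-1), w ≠ 0 :=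
    (eventually_ne_nhds (by norm_num : (-1 : ℂ) ≠ 0)).filter_mono nhdsWithin_le_nhds
  filter_upwards [h0, self_mem_nhdsWithin] with w hw hw1
  have hw1 : w + 1 ≠ 0 := fun h => hw1 (eq_neg_of_add_eq_zero_left h)
  rw [polefn_eq, PP_mul t ht0 ht1 w⁻¹]
  have : w * ((1 + w⁻¹) * PP t (t * w⁻¹)) * PP t (t * w)
      = (w + 1) * (PP t (t * w⁻¹) * PP t (t * w)) := by field_simp
  rw [this, one_div, one_div, mul_inv (w + 1), mul_inv_cancel_left₀ hw1]

lemma scale_tendsto (a : ℂ) (ha : a ≠ 0) (p : ℂ) :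
    Filter.Tendsto (fun w : ℂ => a * w) (𝓝[≠] p) (𝓝[≠] (a * p)) := by
  refine tendsto_nhdsWithin_iff.2 ⟨?_, ?_⟩
  · exact ((continuous_const_mul a).tendsto p).mono_left nhdsWithin_le_nhds
  · filter_upwards [self_mem_nhdsWithin] with w hw h
    exact hw (mul_left_cancel₀ ha h)

lemma step_up (t : ℝ) (ht0 : 0 < t) (ht1 : t < 1) (p c : ℂ) (hp : p ≠ 0)
    (h : Filter.Tendsto (fun w : ℂ => (w + p) * polefn t w) (𝓝[≠] (-p)) (𝓝 c)) :
    Filter.Tendsto (fun w : ℂ => (w + t * p) * polefn t w) (𝓝[≠] (-(t * p)))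
      (𝓝 (-(t * p) * c)) := by
  have ht : (t : ℂ) ≠ 0 := by exact_mod_cast ht0.ne'
  have hs := scale_tendsto (t : ℂ)⁻¹ (inv_ne_zero ht) (-(t * p))
  have e : (t : ℂ)⁻¹ * (-(t * p)) = -p := by field_simp
  rw [e] at hs
  have hid : Filter.Tendsto (fun w : ℂ => w) (𝓝[≠] (-(t * p))) (𝓝 (-(t * p))) :=
    Filter.tendsto_id.mono_left nhdsWithin_le_nhds
  refine (hid.mul (h.comp hs)).congr' ?_
  have h0 : ∀ᶠ w : ℂ in 𝓝[≠] (-(t * p)), w ≠ 0 :=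
    (eventually_ne_nhds (neg_ne_zero.2 (mul_ne_zero ht hp))).filter_mono nhdsWithin_le_nhds
  filter_upwards [h0] with w hw
  have := polefn_t t ht0 ht1 ((t : ℂ)⁻¹ * w) (mul_ne_zero (inv_ne_zero ht) hw)
  rw [mul_inv_cancel_left₀ ht] at this
  rw [this, Function.comp]
  field_simp

lemma step_down (t : ℝ) (ht0 : 0 < t) (ht1 : t < 1) (p c : ℂ) (hp : p ≠ 0)
    (h : Filter.Tendsto (fun w : ℂ => (w + t * p) * polefn t w) (𝓝[≠] (-(t * p)))
      (𝓝 (-(t * p) * c))) :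
    Filter.Tendsto (fun w : ℂ => (w + p) * polefn t w) (𝓝[≠] (-p)) (𝓝 c) := by
  have ht : (t : ℂ) ≠ 0 := by exact_mod_cast ht0.ne'
  have hs := scale_tendsto (t : ℂ) ht (-p)
  rw [mul_neg] at hs
  have hid : Filter.Tendsto (fun w : ℂ => t * w) (𝓝[≠] (-p)) (𝓝 (-(t * p))) :=
    hs.mono_right nhdsWithin_le_nhds
  have hne : -(t * p) ≠ 0 := neg_ne_zero.2 (mul_ne_zero ht hp)
  have := (h.comp hs).div hid hne
  rw [mul_div_cancel_left₀ _ hne] at this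
  refine this.congr' ?_
  have h0 : ∀ᶠ w : ℂ in 𝓝[≠] (-p), w ≠ 0 :=
    (eventually_ne_nhds (neg_ne_zero.2 hp)).filter_mono nhdsWithin_le_nhds
  filter_upwards [h0] with w hw
  simp only [Function.comp, Pi.div_apply]
  rw [polefn_t t ht0 ht1 w hw]
  field_simp

lemma coef_step (t : ℝ) (ht0 : 0 < t) (m : ℤ) (D : ℂ) :
    (-1 : ℂ) ^ (m + 1) * (t : ℂ) ^ ((m + 1) * (m + 1 + 1) / 2) / D
      = -(t * (t : ℂ) ^ m) * ((-1 : ℂ) ^ m * (t : ℂ) ^ (m * (m + 1) / 2) / D) := by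
  have ht : (t : ℂ) ≠ 0 := by exact_mod_cast ht0.ne'
  have e : (m + 1) * (m + 1 + 1) / 2 = m * (m + 1) / 2 + (m + 1) := by
    rw [show (m + 1) * (m + 1 + 1) = m * (m + 1) + (m + 1) * 2 by ring,
      Int.add_mul_ediv_right _ _ (by norm_num)]
  rw [e, zpow_add₀ ht, zpow_add_one₀ ht, zpow_add_one₀ (by norm_num : (-1 : ℂ) ≠ 0)]
  ring

theorem stmt6 (t : ℝ) (ht0 : 0 < t) (ht1 : t < 1) (m : ℤ) :
    Filter.Tendsto (fun w : ℂ => (w + (t : ℂ) ^ m) * polefn t w)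
      (𝓝[≠] (-(t : ℂ) ^ m))
      (𝓝 ((-1 : ℂ) ^ m * (t : ℂ) ^ (m * (m + 1) / 2) / ((tPochInf t : ℝ) : ℂ) ^ 2)) ∧
    (-1 : ℂ) ^ m * (t : ℂ) ^ (m * (m + 1) / 2) / ((tPochInf t : ℝ) : ℂ) ^ 2 ≠ 0 := by
  have ht : (t : ℂ) ≠ 0 := by exact_mod_cast ht0.ne'
  constructor
  · induction m using Int.induction_on with
    | zero => simpa using base t ht0 ht1
    | succ k ih =>
      have := step_up t ht0 ht1 _ _ (zpow_ne_zero _ ht) ih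
      rw [coef_step t ht0, zpow_add_one₀ ht, mul_comm _ (t : ℂ)]
      exact this
    | pred k ih =>
      apply step_down t ht0 ht1 _ _ (zpow_ne_zero _ ht)
      rw [← coef_step t ht0]
      have e : (t : ℂ) * (t : ℂ) ^ (-(k : ℤ) - 1) = (t : ℂ) ^ (-(k : ℤ)) := by
        rw [mul_comm, ← zpow_add_one₀ ht, sub_add_cancel]
      rw [e, sub_add_cancel]
      exact ih
  · rw [← PP_neg t ht0 ht1]
    exact div_ne_zero (mul_ne_zero (zpow_ne_zero _ (by norm_num)) (zpow_ne_zero _ ht))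
      (pow_ne_zero _ (PP_neg_ne t ht0 ht1))
end
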